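/- Let R be a commutative Noetherian ring, r ≥ 1 an integer, I_1,…,I_r ideals of R, and M a finitely generated R-module. If the length λ_R(M/I^n M) is finite for all n ≫ 0, then there exist c ∈ ℕ^r and a polynomial P ∈ ℚ[x_1,…,x_r] such that λ_R(M/I^n M) = P(n) for all n ≥ c. Moreover, if in addition R is local, M ≠ 0, and each ideal I_i is proper, then P can be chosen so that its total degree equals dim_R(M), the Krull dimension of R/ann_R(M). -/

import Mathlib

/-- The product ideal `I^n = I_1^{n_1} ⋯ I_r^{n_r}`. -/
abbrev prodPow {R : Type*} [CommRing R] {r : ℕ} (I : Fin r → Ideal R)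
    (n : Fin r → ℕ) : Ideal R :=
  ∏ i, I i ^ n i

/-- The length `λ_R(X)` of an `R`-module `X`, as the supremum of lengths of chains
of submodules of `X` (an element of `WithBot ℕ∞`; it is `⊤` iff `X` has infinite
length). -/
noncomputable def moduleLength (R X : Type*) [CommRing R] [AddCommGroup X]
    [Module R X] : WithBot ℕ∞ :=
  Order.krullDim (Submodule R X)


/-! numeric part -/
def IsPolyFun {r : ℕ} (g : (Fin r → ℕ) → ℚ) : Prop :=
  ∃ P : MvPolynomial (Fin r) ℚ, ∀ n, g n = MvPolynomial.eval (fun i => (n i : ℚ)) P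

def EvPoly {r : ℕ} (g : (Fin r → ℕ) → ℚ) : Prop :=
  ∃ (c : Fin r → ℕ) (P : MvPolynomial (Fin r) ℚ),
    ∀ n, c ≤ n → g n = MvPolynomial.eval (fun i => (n i : ℚ)) P

lemma IsPolyFun.add {r : ℕ} {f g : (Fin r → ℕ) → ℚ} (hf : IsPolyFun f) (hg : IsPolyFun g) :
    IsPolyFun (fun n => f n + g n) := by
  obtain ⟨P, hP⟩ := hf
  obtain ⟨Q, hQ⟩ := hg
  exact ⟨P + Q, fun n => by simp [hP, hQ]⟩

lemma EvPoly.sub {r : ℕ} {f g : (Fin r → ℕ) → ℚ} (hf : EvPoly f) (hg : EvPoly g) :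
    EvPoly (fun n => f n - g n) := by
  obtain ⟨c, P, hP⟩ := hf
  obtain ⟨c', Q, hQ⟩ := hg
  exact ⟨c ⊔ c', P - Q, fun n hn => by
    simp [hP n (le_trans le_sup_left hn), hQ n (le_trans le_sup_right hn)]⟩

lemma EvPoly.congr {r : ℕ} {f g : (Fin r → ℕ) → ℚ} (hf : EvPoly f) (c : Fin r → ℕ)
    (h : ∀ n, c ≤ n → g n = f n) : EvPoly g := by
  obtain ⟨c', P, hP⟩ := hf
  exact ⟨c ⊔ c', P, fun n hn => by
    rw [h n (le_trans le_sup_left hn), hP n (le_trans le_sup_right hn)]⟩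

lemma EvPoly.shift {r : ℕ} {f : (Fin r → ℕ) → ℚ} (hf : EvPoly f) (d : Fin r → ℕ) :
    EvPoly (fun n => f (n + d)) := by
  obtain ⟨c, P, hP⟩ := hf
  refine ⟨c, MvPolynomial.bind₁ (fun i => MvPolynomial.X i + MvPolynomial.C (d i : ℚ)) P, ?_⟩
  intro n hn
  beta_reduce
  rw [hP _ (le_trans hn (by simp)), ← MvPolynomial.coe_aeval_eq_eval, ← MvPolynomial.coe_aeval_eq_eval]
  simp only [RingHom.coe_coe, MvPolynomial.aeval_bind₁]
  simp

lemma EvPoly.of_shift {r : ℕ} {f : (Fin r → ℕ) → ℚ} (d : Fin r → ℕ)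
    (hf : EvPoly (fun n => f (n + d))) : EvPoly f := by
  obtain ⟨c, P, hP⟩ := hf
  refine ⟨c + d, MvPolynomial.bind₁ (fun i => MvPolynomial.X i - MvPolynomial.C (d i : ℚ)) P, ?_⟩
  intro n hn
  have hdn : d ≤ n := le_trans (by simp) hn
  have := hP (n - d) (by intro i; have := hn i; simp at this ⊢; omega)
  simp only at this
  rw [tsub_add_cancel_of_le hdn] at this
  rw [this, ← MvPolynomial.coe_aeval_eq_eval, ← MvPolynomial.coe_aeval_eq_eval]
  simp only [RingHom.coe_coe, MvPolynomial.aeval_bind₁]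
  congr 2
  ext i
  simp [Nat.cast_sub (hdn i)]

lemma faulhaber (p : ℕ) : ∃ q : Polynomial ℚ, ∀ N : ℕ, ∑ k ∈ Finset.range N, (k : ℚ) ^ p = q.eval (N : ℚ) := by
  refine ⟨∑ i ∈ Finset.range (p + 1), Polynomial.C (bernoulli i * ((p + 1).choose i) / (p + 1)) *
    Polynomial.X ^ (p + 1 - i), fun N => ?_⟩
  rw [sum_range_pow, Polynomial.eval_finsetSum]
  refine Finset.sum_congr rfl fun i _ => ?_
  simp
  ring

lemma IsPolyFun.sum_range {r : ℕ} {h : (Fin r → ℕ) → ℚ} (hh : IsPolyFun h) (j : Fin r) :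
    IsPolyFun (fun n => ∑ k ∈ Finset.range (n j), h (Function.update n j k)) := by
  obtain ⟨P, hP⟩ := hh
  suffices H : IsPolyFun (fun n : Fin r → ℕ => ∑ k ∈ Finset.range (n j),
      MvPolynomial.eval (fun i => ((Function.update n j k i : ℕ) : ℚ)) P) by
    simpa only [hP] using H
  clear hP
  induction P using MvPolynomial.induction_on' with
  | monomial u a =>
    obtain ⟨q, hq⟩ := faulhaber (u j)
    refine ⟨MvPolynomial.C a * (∏ i ∈ Finset.univ.erase j, MvPolynomial.X i ^ u i) *
      Polynomial.aeval (MvPolynomial.X j) q, fun n => ?_⟩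
    have h1 : MvPolynomial.eval (fun i => (n i : ℚ)) (Polynomial.aeval (MvPolynomial.X j) q)
        = q.eval (n j : ℚ) := by
      rw [← MvPolynomial.coe_aeval_eq_eval, RingHom.coe_coe, ← Polynomial.aeval_algHom_apply]
      simp [Polynomial.aeval_def]
    rw [map_mul, h1, ← hq, Finset.mul_sum]
    refine Finset.sum_congr rfl fun k _ => ?_
    rw [MvPolynomial.eval_monomial, Finsupp.prod_fintype _ _ (by simp),
      ← Finset.mul_prod_erase _ _ (Finset.mem_univ j)]
    have : ∏ x ∈ Finset.univ.erase j, ((Function.update n j k x : ℕ) : ℚ) ^ u x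
        = ∏ x ∈ Finset.univ.erase j, (n x : ℚ) ^ u x := by
      refine Finset.prod_congr rfl fun x hx => ?_
      rw [Function.update_of_ne (Finset.ne_of_mem_erase hx)]
    rw [this]
    simp
    ring
  | add p q hp hq =>
    simpa [Finset.sum_add_distrib] using hp.add hq

lemma IsPolyFun.of_diff {r : ℕ} {g : (Fin r → ℕ) → ℚ}
    (h : ∀ i, IsPolyFun (fun n => g (n + Pi.single i 1) - g n)) : IsPolyFun g := by
  classical
  suffices H : ∀ S : Finset (Fin r), IsPolyFun (fun n => g (fun i => if i ∈ S then n i else 0)) by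
    simpa using H Finset.univ
  intro S
  induction S using Finset.induction_on with
  | empty => exact ⟨MvPolynomial.C (g fun _ => 0), fun n => by simp⟩
  | insert j S hj ih =>
    have h1 : IsPolyFun (fun n : Fin r → ℕ =>
        (fun n => g (n + Pi.single j 1) - g n) (fun i => if i ∈ insert j S then n i else 0)) := by
      obtain ⟨P, hP⟩ := h j
      refine ⟨MvPolynomial.bind₁ (fun i => if i ∈ insert j S then MvPolynomial.X i else 0) P, ?_⟩
      intro n
      rw [hP, ← MvPolynomial.coe_aeval_eq_eval, ← MvPolynomial.coe_aeval_eq_eval]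
      simp only [RingHom.coe_coe, MvPolynomial.aeval_bind₁]
      congr 2
      ext i
      split_ifs <;> simp
    have h2 := ih.add (h1.sum_range j)
    obtain ⟨P, hP⟩ := h2
    refine ⟨P, fun n => ?_⟩
    rw [← hP]
    have key : ∀ N : ℕ, g (fun i => if i ∈ insert j S then Function.update n j N i else 0) =
        g (fun i => if i ∈ S then n i else 0) + ∑ k ∈ Finset.range N,
        (g ((fun i => if i ∈ insert j S then Function.update n j k i else 0) + Pi.single j 1) -
          g (fun i => if i ∈ insert j S then Function.update n j k i else 0)) := by
      intro N
      induction N with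
      | zero =>
        simp
        congr 1
        ext i
        by_cases hi : i = j
        · subst hi; simp [hj]
        · simp [hi]
      | succ N ihN =>
        rw [Finset.sum_range_succ, ← add_assoc, ← ihN]
        have : (fun i => if i ∈ insert j S then Function.update n j (N + 1) i else 0) =
          (fun i => if i ∈ insert j S then Function.update n j N i else 0) + Pi.single j 1 := by
          ext i
          by_cases hi : i = j
          · subst hi; simp
          · simp [hi]
        rw [this]
        ring
    have := key (n j)
    simpa using this

lemma EvPoly.of_diff {r : ℕ} {g : (Fin r → ℕ) → ℚ}
    (h : ∀ i, EvPoly (fun n => g (n + Pi.single i 1) - g n)) : EvPoly g := by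
  choose c P hP using h
  let d : Fin r → ℕ := Finset.univ.sup c
  refine EvPoly.of_shift d ?_
  have : IsPolyFun (fun n => g (n + d)) := by
    refine IsPolyFun.of_diff fun i => ?_
    refine ⟨MvPolynomial.bind₁ (fun j => MvPolynomial.X j + MvPolynomial.C (d j : ℚ)) (P i), ?_⟩
    intro n
    have h1 := hP i (n + d) (le_trans (Finset.le_sup (f := c) (Finset.mem_univ i)) (by simp [d]))
    simp only at h1
    beta_reduce
    rw [add_right_comm, h1, ← MvPolynomial.coe_aeval_eq_eval, ← MvPolynomial.coe_aeval_eq_eval]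
    simp only [RingHom.coe_coe, MvPolynomial.aeval_bind₁]
    simp
  obtain ⟨P, hP⟩ := this
  exact ⟨0, P, fun n _ => hP n⟩


section QL
variable {R M : Type*} [CommRing R] [AddCommGroup M] [Module R M]

/-- length of `P / Q` -/
noncomputable def ql (P Q : Submodule R M) : ℕ∞ := Module.length R (P ⧸ Q.submoduleOf P)

lemma ql_eq_of_surj {X : Type*} [AddCommGroup X] [Module R X] {P Q : Submodule R M}
    (g : P →ₗ[R] X) (hg : Function.Surjective g) (hk : LinearMap.ker g = Q.submoduleOf P) :
    ql P Q = Module.length R X := by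
  unfold ql
  rw [← hk]
  exact (g.quotKerEquivOfSurjective hg).length_eq

lemma ql_add {P K Q : Submodule R M} (h1 : Q ≤ K) (h2 : K ≤ P) :
    ql P Q = ql K Q + ql P K := by
  unfold ql
  have e1 : Q.submoduleOf K ≤ (Q.submoduleOf P).comap (Submodule.inclusion h2) := by
    intro x hx
    simpa [Submodule.submoduleOf] using hx
  have e2 : Q.submoduleOf P ≤ K.submoduleOf P := fun x hx => h1 hx
  refine Module.length_eq_add_of_exact (Submodule.mapQ _ _ (Submodule.inclusion h2) e1)
    (Submodule.factor e2) ?_ (Submodule.factor_surjective e2) ?_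
  · rw [← LinearMap.ker_eq_bot, Submodule.ker_mapQ, eq_bot_iff, Submodule.map_le_iff_le_comap]
    intro x hx
    rw [Submodule.mem_comap, Submodule.mem_bot, Submodule.mkQ_apply,
      Submodule.Quotient.mk_eq_zero]
    exact hx
  · intro y
    obtain ⟨y, rfl⟩ := Submodule.Quotient.mk_surjective _ y
    constructor
    · intro hy
      have hy' : (y : M) ∈ K := by
        have : Submodule.Quotient.mk (p := K.submoduleOf P) y = 0 := hy
        rw [Submodule.Quotient.mk_eq_zero] at this
        exact this
      exact ⟨Submodule.Quotient.mk ⟨y, hy'⟩, rfl⟩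
    · rintro ⟨x, hx⟩
      obtain ⟨x, rfl⟩ := Submodule.Quotient.mk_surjective _ x
      rw [← hx]
      show Submodule.Quotient.mk (p := K.submoduleOf P) _ = 0
      rw [Submodule.Quotient.mk_eq_zero]
      exact x.2

lemma ql_top (Q : Submodule R M) : ql ⊤ Q = Module.length R (M ⧸ Q) := by
  refine ql_eq_of_surj (Q.mkQ ∘ₗ (⊤ : Submodule R M).subtype) ?_ ?_
  · intro y
    obtain ⟨y, rfl⟩ := Submodule.Quotient.mk_surjective _ y
    exact ⟨⟨y, trivial⟩, rfl⟩
  · rw [LinearMap.ker_comp, Submodule.ker_mkQ]; rfl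

lemma length_quot_eq {P Q : Submodule R M} (h : Q ≤ P) :
    Module.length R (M ⧸ Q) = ql P Q + Module.length R (M ⧸ P) := by
  rw [← ql_top, ← ql_top, ql_add h le_top]

lemma ql_map (f : M →ₗ[R] M) (P Q' : Submodule R M) :
    ql P (P ⊓ Q'.comap f) = ql (Q' ⊔ P.map f) Q' := by
  let g : P →ₗ[R] M ⧸ Q' := Q'.mkQ ∘ₗ f ∘ₗ P.subtype
  let g' : (Q' ⊔ P.map f : Submodule R M) →ₗ[R] M ⧸ Q' := Q'.mkQ ∘ₗ Submodule.subtype _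
  have hr : LinearMap.range g = LinearMap.range g' := by
    simp only [g, g', LinearMap.range_comp, Submodule.range_subtype, Submodule.map_sup]
    simp
  rw [ql_eq_of_surj (Q := P ⊓ Q'.comap f) g.rangeRestrict g.surjective_rangeRestrict,
    ql_eq_of_surj (Q := Q') g'.rangeRestrict g'.surjective_rangeRestrict, hr]
  · rw [LinearMap.ker_rangeRestrict]; simp only [g']; rw [LinearMap.ker_comp, Submodule.ker_mkQ]; rfl
  · rw [LinearMap.ker_rangeRestrict]; simp only [g]; rw [LinearMap.ker_comp, Submodule.ker_mkQ]
    ext x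
    simp [Submodule.submoduleOf]

lemma ql_exact (f : M →ₗ[R] M) {P Q P' Q' : Submodule R M} (hP : P ≤ P'.comap f)
    (hQ : Q ≤ Q'.comap f) (h : Q ≤ P) (h' : Q' ≤ P') :
    ql P Q + ql P' (Q' ⊔ P.map f) = ql P' Q' + ql (P ⊓ Q'.comap f) Q := by
  rw [ql_add (P := P) (K := P ⊓ Q'.comap f) (Q := Q) (le_inf h hQ) inf_le_left,
    ql_map, ql_add (P := P') (K := Q' ⊔ P.map f) (Q := Q') le_sup_left
      (sup_le h' (Submodule.map_le_iff_le_comap.2 hP))]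
  ring

lemma ql_self (P : Submodule R M) : ql P P = 0 := by
  unfold ql
  rw [Module.length_eq_zero_iff, Submodule.Quotient.subsingleton_iff]
  simp
end QL

section Rees
variable {R M : Type*} [CommRing R] [AddCommGroup M] [Module R M] {r : ℕ}
  {V : Type} (a : V → R) (col : V → Fin r)

/-- stable families -/
def Stab (P : (Fin r → ℕ) → Submodule R M) : Prop :=
  ∀ v n, P n ≤ (P (n + Pi.single (col v) 1)).comap (LinearMap.lsmul R M (a v))

/-- the presentation of the multi Rees algebra -/
noncomputable def reesMap : MvPolynomial V R →ₐ[R] MvPolynomial (Fin r) R :=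
  MvPolynomial.aeval (fun v => MvPolynomial.C (a v) * MvPolynomial.X (col v))

noncomputable def famEval {g : ℕ} (m : Fin g → M) (n : Fin r → ℕ) (f : Fin g → MvPolynomial V R) : M :=
  ∑ j, MvPolynomial.coeff (Finsupp.equivFunOnFinite.symm n) (reesMap a col (f j)) • m j

lemma famEval_add {g : ℕ} (m : Fin g → M) (n : Fin r → ℕ) (f f' : Fin g → MvPolynomial V R) :
    famEval a col m n (f + f') = famEval a col m n f + famEval a col m n f' := by
  simp [famEval, add_smul, Finset.sum_add_distrib]

lemma famEval_C {g : ℕ} (m : Fin g → M) (n : Fin r → ℕ) (x : R) (f : Fin g → MvPolynomial V R) :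
    famEval a col m n ((MvPolynomial.C x : MvPolynomial V R) • f) = x • famEval a col m n f := by
  simp only [famEval, Finset.smul_sum, Pi.smul_apply, smul_eq_mul, map_mul]
  refine Finset.sum_congr rfl fun j _ => ?_
  have : reesMap a col (MvPolynomial.C x) = MvPolynomial.C x := by
    rw [← MvPolynomial.algebraMap_eq, ← MvPolynomial.algebraMap_eq]; exact AlgHom.commutes _ _
  rw [this, MvPolynomial.coeff_C_mul, mul_smul]

lemma famEval_X {g : ℕ} (m : Fin g → M) (n : Fin r → ℕ) (v : V) (f : Fin g → MvPolynomial V R) :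
    famEval a col m (n + Pi.single (col v) 1) ((MvPolynomial.X v : MvPolynomial V R) • f) = a v • famEval a col m n f := by
  simp only [famEval, Finset.smul_sum, Pi.smul_apply, smul_eq_mul, map_mul]
  refine Finset.sum_congr rfl fun j _ => ?_
  have : reesMap a col (MvPolynomial.X v) = MvPolynomial.C (a v) * MvPolynomial.X (col v) := by
    simp [reesMap]
  have e : Finsupp.equivFunOnFinite.symm (n + Pi.single (col v) 1) =
    Finsupp.single (col v) 1 + Finsupp.equivFunOnFinite.symm n := by
    ext i
    simp [Finsupp.single_apply, Pi.single_apply, add_comm, eq_comm]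
  rw [this, mul_assoc, MvPolynomial.coeff_C_mul, e, MvPolynomial.coeff_X_mul, mul_smul]

lemma famEval_X0 {g : ℕ} (m : Fin g → M) (n : Fin r → ℕ) (v : V) (f : Fin g → MvPolynomial V R)
    (hn : n (col v) = 0) :
    famEval a col m n ((MvPolynomial.X v : MvPolynomial V R) • f) = 0 := by
  simp only [famEval, Pi.smul_apply, smul_eq_mul, map_mul]
  refine Finset.sum_eq_zero fun j _ => ?_
  have : reesMap a col (MvPolynomial.X v) = MvPolynomial.C (a v) * MvPolynomial.X (col v) := by
    simp [reesMap]
  rw [this, mul_assoc, MvPolynomial.coeff_C_mul, MvPolynomial.coeff_X_mul']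
  simp [hn]

/-- the submodule attached to a stable family -/
noncomputable def famSub {g : ℕ} (m : Fin g → M) (P : (Fin r → ℕ) → Submodule R M)
    (hP : Stab a col P) : Submodule (MvPolynomial V R) (Fin g → MvPolynomial V R) where
  carrier := {f | ∀ n, famEval a col m n f ∈ P n}
  add_mem' := by
    intro f f' hf hf' n
    rw [famEval_add]
    exact add_mem (hf n) (hf' n)
  zero_mem' := by
    intro n
    simp [famEval]
  smul_mem' := by
    intro p
    induction p using MvPolynomial.induction_on with
    | C x =>
      intro f hf n
      rw [famEval_C]
      exact Submodule.smul_mem _ _ (hf n)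
    | add p q hp hq =>
      intro f hf n
      rw [add_smul, famEval_add]
      exact add_mem (hp hf n) (hq hf n)
    | mul_X p v hp =>
      intro f hf
      rw [mul_smul]
      apply hp
      intro n
      by_cases hn : n (col v) = 0
      · rw [famEval_X0 _ _ _ _ _ _ hn]; exact zero_mem _
      · have : n = (n - Pi.single (col v) 1) + Pi.single (col v) 1 := by
          rw [tsub_add_cancel_of_le]
          intro i
          by_cases hi : i = col v
          · subst hi; simp; omega
          · simp [hi]
        rw [this, famEval_X]
        exact hP v _ (hf _)

end Rees


section Main1
variable {R M : Type*} [CommRing R] [AddCommGroup M] [Module R M] {r : ℕ}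
  {V : Type} (a : V → R) (col : V → Fin r) (I : Fin r → Ideal R)

def GoodDeg (J : Ideal R) (u : Fin r →₀ ℕ) : Prop :=
  ∀ b ∈ J, MvPolynomial.monomial u b ∈ (reesMap a col).range

lemma GoodDeg.mul {J K : Ideal R} {u v : Fin r →₀ ℕ} (hJ : GoodDeg a col J u)
    (hK : GoodDeg a col K v) : GoodDeg a col (J * K) (u + v) := by
  intro b hb
  refine Submodule.mul_induction_on hb ?_ ?_
  · intro x hx y hy
    rw [← MvPolynomial.monomial_mul]
    exact mul_mem (hJ x hx) (hK y hy)
  · intro x y hx hy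
    rw [map_add]
    exact add_mem hx hy

lemma GoodDeg.one : GoodDeg a col (1 : Ideal R) 0 := by
  intro b _
  exact (reesMap a col).range.algebraMap_mem b

lemma GoodDeg.pow {J : Ideal R} {u : Fin r →₀ ℕ} (hJ : GoodDeg a col J u) (k : ℕ) :
    GoodDeg a col (J ^ k) (k • u) := by
  induction k with
  | zero => simpa using GoodDeg.one a col
  | succ k ih =>
    rw [pow_succ, succ_nsmul]
    exact ih.mul _ _ hJ

lemma GoodDeg.prodPow' (hI : ∀ i, I i = Ideal.span (a '' {v | col v = i})) (n : Fin r → ℕ) :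
    GoodDeg a col (prodPow I n) (Finsupp.equivFunOnFinite.symm n) := by
  have h1 : ∀ i, GoodDeg a col (I i) (Finsupp.single i 1) := by
    intro i b hb
    rw [hI i] at hb
    refine Submodule.span_induction (p := fun b _ => MvPolynomial.monomial (Finsupp.single i 1) b ∈ (reesMap a col).range) ?_ ?_ ?_ ?_ hb
    · rintro x ⟨v, hv, rfl⟩
      refine ⟨MvPolynomial.X v, ?_⟩
      have hv : col v = i := hv
      simp [reesMap, hv, MvPolynomial.C_mul_X_eq_monomial]
    · simp
    · intro x y _ _ hx hy
      rw [map_add]; exact add_mem hx hy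
    · intro c x _ hx
      rw [smul_eq_mul, ← MvPolynomial.C_mul_monomial]
      exact mul_mem ((reesMap a col).range.algebraMap_mem c) hx
  have h2 : ∀ S : Finset (Fin r), GoodDeg a col (∏ i ∈ S, I i ^ n i)
      (∑ i ∈ S, n i • Finsupp.single i 1) := by
    intro S
    induction S using Finset.induction_on with
    | empty => simpa using GoodDeg.one a col
    | insert i S hi ih =>
      rw [Finset.prod_insert hi, Finset.sum_insert hi]
      exact ((h1 i).pow _ _ _).mul _ _ ih
  convert h2 Finset.univ using 1
  ext i
  simp [Finsupp.single_apply, Finsupp.finsetSum_apply]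

lemma exists_famEval (hI : ∀ i, I i = Ideal.span (a '' {v | col v = i})) {g : ℕ} (m : Fin g → M)
    (hm : Submodule.span R (Set.range m) = ⊤) (n : Fin r → ℕ) (y : M)
    (hy : y ∈ prodPow I n • (⊤ : Submodule R M)) :
    ∃ f : Fin g → MvPolynomial V R, famEval a col m n f = y ∧
      ∀ n', n' ≠ n → famEval a col m n' f = 0 := by
  rw [← hm, Submodule.mem_ideal_smul_span_iff_exists_sum] at hy
  obtain ⟨b, hb, hby⟩ := hy
  choose f hf using fun j => GoodDeg.prodPow' a col I hI n (b j) (hb j)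
  have hf' : ∀ j, reesMap a col (f j) = MvPolynomial.monomial (Finsupp.equivFunOnFinite.symm n) (b j) := hf
  refine ⟨f, ?_, ?_⟩
  · rw [← hby, Finsupp.sum_fintype _ _ (by simp)]
    simp [famEval, hf']
  · intro n' hn'
    refine Finset.sum_eq_zero fun j _ => ?_
    rw [hf', MvPolynomial.coeff_monomial, if_neg, zero_smul]
    intro h
    exact hn' (Finsupp.equivFunOnFinite.symm.injective h).symm

lemma acc_lemma [Finite V] [IsNoetherianRing R] [Module.Finite R M]
    (hI : ∀ i, I i = Ideal.span (a '' {v | col v = i}))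
    (P Q : (Fin r → ℕ) → Submodule R M) (hP : Stab a col P) (hQ : Stab a col Q)
    (hQP : ∀ n, Q n ≤ P n) (hPR : ∀ n, P n ≤ prodPow I n • ⊤) (i : Fin r)
    (hi : ∀ v, col v = i → ∀ n, P n ≤ (Q (n + Pi.single (col v) 1)).comap (LinearMap.lsmul R M (a v))) :
    ∃ N, ∀ n, N < n i → P n = Q n := by
  obtain ⟨g, m, hm⟩ := Module.Finite.exists_fin (R := R) (M := M)
  let F : ℕ → (Fin r → ℕ) → Submodule R M := fun k n => if n i ≤ k then P n else Q n
  have hQF : ∀ k n, Q n ≤ F k n := by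
    intro k n
    simp only [F]; split_ifs
    · exact hQP n
    · exact le_rfl
  have hF : ∀ k, Stab a col (F k) := by
    intro k v n
    by_cases hv : col v = i
    · by_cases hn : n i ≤ k
      · have : F k n = P n := if_pos hn
        rw [this]
        exact (hi v hv n).trans (Submodule.comap_mono (hQF _ _))
      · have : F k n = Q n := if_neg hn
        rw [this]
        exact (hQ v n).trans (Submodule.comap_mono (hQF _ _))
    · have e : (n + Pi.single (col v) 1 : Fin r → ℕ) i = n i := by simp [Ne.symm hv]
      simp only [F, e]
      split_ifs
      · exact hP v n
      · exact hQ v n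
  have hmono : Monotone (fun k => famSub a col m (F k) (hF k)) := by
    intro k l hkl f hf n
    refine (?_ : F k n ≤ F l n) (hf n)
    simp only [F]
    split_ifs with h1 h2 h2
    · exact le_rfl
    · omega
    · exact hQP n
    · exact le_rfl
  obtain ⟨N, hN⟩ := monotone_stabilizes_iff_noetherian.2
    (inferInstance : IsNoetherian (MvPolynomial V R) (Fin g → MvPolynomial V R)) ⟨_, hmono⟩
  refine ⟨N, fun n hn => le_antisymm ?_ (hQP n)⟩
  intro y hy
  obtain ⟨f, hf, hf'⟩ := exists_famEval a col I hI m hm n y (hPR n hy)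
  have h1 : f ∈ famSub a col m (F (n i)) (hF _) := by
    intro n'
    by_cases hn' : n' = n
    · subst hn'
      rw [hf]
      simpa [F] using hy
    · rw [hf' n' hn']; exact zero_mem _
  have h2 : famSub a col m (F N) (hF N) = famSub a col m (F (n i)) (hF _) := hN (n i) hn.le
  rw [← h2] at h1
  have h3 : famEval a col m n f ∈ F N n := h1 n
  rw [hf] at h3
  simpa [F, not_le.2 hn] using h3

lemma toNat_aux {a b c d : ℕ∞} (h : a + b = c + d) (ha : a ≠ ⊤) (hb : b ≠ ⊤) (hc : c ≠ ⊤)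
    (hd : d ≠ ⊤) : (c.toNat : ℚ) - a.toNat = b.toNat - d.toNat := by
  lift a to ℕ using ha
  lift b to ℕ using hb
  lift c to ℕ using hc
  lift d to ℕ using hd
  have : (a + b : ℚ) = c + d := by exact_mod_cast h
  simp
  linarith

lemma main_ql_aux [Fintype V] [IsNoetherianRing R] [Module.Finite R M]
    (hI : ∀ i, I i = Ideal.span (a '' {v | col v = i}))
    (T : Finset V) (P Q : (Fin r → ℕ) → Submodule R M) (hP : Stab a col P) (hQ : Stab a col Q)
    (hQP : ∀ n, Q n ≤ P n) (hPR : ∀ n, P n ≤ prodPow I n • ⊤)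
    (hT : ∀ v, v ∉ T → ∀ n, P n ≤ (Q (n + Pi.single (col v) 1)).comap (LinearMap.lsmul R M (a v)))
    (hfin : ∃ c, ∀ n, c ≤ n → ql (P n) (Q n) ≠ ⊤)
    (ih : ∀ T' : Finset V, T'.card + 1 = T.card →
      ∀ (P Q : (Fin r → ℕ) → Submodule R M), Stab a col P → Stab a col Q →
      (∀ n, Q n ≤ P n) → (∀ n, P n ≤ prodPow I n • ⊤) →
      (∀ v, v ∉ T' → ∀ n, P n ≤ (Q (n + Pi.single (col v) 1)).comap (LinearMap.lsmul R M (a v))) →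
      (∃ c, ∀ n, c ≤ n → ql (P n) (Q n) ≠ ⊤) →
      EvPoly (fun n => ((ql (P n) (Q n)).toNat : ℚ))) :
    EvPoly (fun n => ((ql (P n) (Q n)).toNat : ℚ)) := by
  classical
  by_cases hcol : ∃ i, ∀ v ∈ T, col v ≠ i
  · obtain ⟨i, hi⟩ := hcol
    obtain ⟨N, hN⟩ := acc_lemma a col I hI P Q hP hQ hQP hPR i
      (fun v hv => hT v (fun hvT => hi v hvT hv))
    refine ⟨fun _ => N + 1, 0, fun n hn => ?_⟩
    beta_reduce
    rw [hN n (hn i), ql_self]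
    simp
  push Not at hcol
  refine EvPoly.of_diff fun i => ?_
  obtain ⟨v, hvT, rfl⟩ := hcol i
  obtain ⟨c, hc⟩ := hfin
  set e : Fin r → ℕ := Pi.single (col v) 1 with he
  set f := LinearMap.lsmul R M (a v) with hf
  -- the kernel and cokernel families
  let K : (Fin r → ℕ) → Submodule R M := fun n => P n ⊓ (Q (n + e)).comap f
  let C : (Fin r → ℕ) → Submodule R M := fun n => Q n ⊔ ⨆ m : {m : Fin r → ℕ // m + e = n}, (P m.1).map f
  have hcomm : ∀ w x, LinearMap.lsmul R M (a w) (f x) = f (LinearMap.lsmul R M (a w) x) := by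
    intro w x
    simp only [hf, LinearMap.lsmul_apply]
    exact smul_comm _ _ _
  have hCe : ∀ n, C (n + e) = Q (n + e) ⊔ (P n).map f := by
    intro n
    simp only [C]
    congr 1
    refine le_antisymm (iSup_le ?_) ?_
    · rintro ⟨m, hm⟩
      obtain rfl := add_right_cancel hm
      exact le_rfl
    · exact le_iSup (fun m : {m : Fin r → ℕ // m + e = n + e} => (P m.1).map f) ⟨n, rfl⟩
  have hKs : Stab a col K := by
    intro w n x hx
    refine ⟨hP w n hx.1, ?_⟩
    have h1 : f x ∈ Q (n + e) := hx.2
    have h2 := hQ w _ h1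
    show f (LinearMap.lsmul R M (a w) x) ∈ Q _
    rw [← hcomm, add_right_comm]
    exact h2
  have hCs : Stab a col C := by
    intro w n
    refine sup_le ((hQ w n).trans (Submodule.comap_mono le_sup_left)) (iSup_le ?_)
    rintro ⟨m, rfl⟩
    rw [Submodule.map_le_iff_le_comap]
    intro x hx
    show LinearMap.lsmul R M (a w) (f x) ∈ C _
    rw [hcomm, add_right_comm, hCe]
    exact Submodule.mem_sup_right (Submodule.mem_map_of_mem (hP w m hx))
  have hQC : ∀ n, Q n ≤ C n := fun n => le_sup_left
  have hQK : ∀ n, Q n ≤ K n := fun n => le_inf (hQP n) (hQ v n)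
  have hKP : ∀ n, K n ≤ P n := fun n => inf_le_left
  have hCP : ∀ n, C n ≤ P n := by
    intro n
    refine sup_le (hQP n) (iSup_le ?_)
    rintro ⟨m, rfl⟩
    rw [Submodule.map_le_iff_le_comap]
    exact hP v m
  have hKfin : ∀ n, c ≤ n → ql (K n) (Q n) ≠ ⊤ := by
    intro n hn h
    apply hc n hn
    rw [ql_add (hQK n) (hKP n), h, top_add]
  have hCfin : ∀ n, c ≤ n → ql (P n) (C n) ≠ ⊤ := by
    intro n hn h
    apply hc n hn
    rw [ql_add (hQC n) (hCP n), h, add_top]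
  have hcard : (T.erase v).card + 1 = T.card := Finset.card_erase_add_one hvT
  have EK := ih (T.erase v) hcard K Q hKs hQ hQK (fun n => (hKP n).trans (hPR n)) (by
    intro w hw n
    by_cases hwv : w = v
    · subst hwv
      exact inf_le_right
    · exact (hKP n).trans (hT w (fun h => hw (Finset.mem_erase.2 ⟨hwv, h⟩)) n)) ⟨c, hKfin⟩
  have EC := ih (T.erase v) hcard P C hP hCs hCP hPR (by
    intro w hw n
    by_cases hwv : w = v
    · subst hwv
      rw [← Submodule.map_le_iff_le_comap, hCe]
      exact le_sup_right
    · exact (hT w (fun h => hw (Finset.mem_erase.2 ⟨hwv, h⟩)) n).trans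
        (Submodule.comap_mono (hQC _))) ⟨c, hCfin⟩
  refine ((EC.shift e).sub EK).congr c fun n hn => ?_
  have hne : c ≤ n + e := le_trans hn (by simp)
  have hex := ql_exact f (hP v n) (hQ v n) (hQP n) (hQP (n + e))
  refine toNat_aux ?_ (hc n hn) (hCfin _ hne) (hc _ hne) (hKfin n hn)
  rw [hCe]
  exact hex

lemma main_ql [Fintype V] [IsNoetherianRing R] [Module.Finite R M]
    (hI : ∀ i, I i = Ideal.span (a '' {v | col v = i})) (k : ℕ) :
    ∀ (T : Finset V), T.card = k → ∀ (P Q : (Fin r → ℕ) → Submodule R M), Stab a col P → Stab a col Q →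
    (∀ n, Q n ≤ P n) → (∀ n, P n ≤ prodPow I n • ⊤) →
    (∀ v, v ∉ T → ∀ n, P n ≤ (Q (n + Pi.single (col v) 1)).comap (LinearMap.lsmul R M (a v))) →
    (∃ c, ∀ n, c ≤ n → ql (P n) (Q n) ≠ ⊤) →
    EvPoly (fun n => ((ql (P n) (Q n)).toNat : ℚ)) := by
  classical
  induction k with
  | zero =>
    intro T hT P Q hP hQ hQP hPR hT' hfin
    exact main_ql_aux a col I hI T P Q hP hQ hQP hPR hT' hfin (fun T' hT' => by omega)
  | succ k ih =>
    intro T hT P Q hP hQ hQP hPR hT' hfin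
    refine main_ql_aux a col I hI T P Q hP hQ hQP hPR hT' hfin (fun T' hTc => ?_)
    exact ih T' (by omega)

lemma prodPow_add_single (n : Fin r → ℕ) (i : Fin r) :
    prodPow I (n + Pi.single i 1) = I i * prodPow I n := by
  classical
  have : ∀ j, I j ^ ((n + Pi.single i 1 : Fin r → ℕ) j) = I j ^ n j * (if j = i then I j else 1) := by
    intro j
    by_cases h : j = i
    · subst h; simp [pow_succ]
    · simp [h]
  simp only [prodPow, this, Finset.prod_mul_distrib]
  rw [mul_comm, Finset.prod_ite_eq']
  simp

lemma main_poly [IsNoetherianRing R] [Module.Finite R M]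
    (hfin : ∃ c : Fin r → ℕ, ∀ n, c ≤ n → Module.length R (M ⧸ (prodPow I n • (⊤ : Submodule R M))) ≠ ⊤) :
    EvPoly (fun n => ((Module.length R (M ⧸ (prodPow I n • (⊤ : Submodule R M)))).toNat : ℚ)) := by
  classical
  have hgen : ∀ i, ∃ (k : ℕ) (s : Fin k → R), Ideal.span (Set.range s) = I i := fun i =>
    Submodule.fg_iff_exists_fin_generating_family.1 (IsNoetherian.noetherian (I i))
  choose k s hs using hgen
  let V := Σ i : Fin r, Fin (k i)
  let a : V → R := fun v => s v.1 v.2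
  let col : V → Fin r := fun v => v.1
  have hI : ∀ i, I i = Ideal.span (a '' {v | col v = i}) := by
    intro i
    rw [← hs i]
    congr 1
    ext x
    constructor
    · rintro ⟨j, rfl⟩
      exact ⟨⟨i, j⟩, rfl, rfl⟩
    · rintro ⟨⟨i', j⟩, h, rfl⟩
      obtain rfl : i' = i := h
      exact ⟨j, rfl⟩
  have haI : ∀ v, a v ∈ I (col v) := by
    intro v
    rw [← hs]
    exact Ideal.subset_span ⟨v.2, rfl⟩
  obtain ⟨c, hc⟩ := hfin
  refine EvPoly.of_diff fun i => ?_
  let P : (Fin r → ℕ) → Submodule R M := fun n => prodPow I n • ⊤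
  let Q : (Fin r → ℕ) → Submodule R M := fun n => prodPow I (n + Pi.single i 1) • ⊤
  have hP : Stab a col P := by
    intro v n x hx
    show a v • x ∈ prodPow I _ • (⊤ : Submodule R M)
    rw [prodPow_add_single, mul_smul]
    exact Submodule.smul_mem_smul (haI v) hx
  have hQ : Stab a col Q := by
    intro v n
    have := hP v (n + Pi.single i 1)
    simp only [Q, add_right_comm n _ (Pi.single i 1)]
    exact this
  have hQP : ∀ n, Q n ≤ P n := by
    intro n
    simp only [Q, P]
    rw [prodPow_add_single, mul_smul]
    exact Submodule.smul_le_right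
  have hlen : ∀ n, Module.length R (M ⧸ Q n) = ql (P n) (Q n) + Module.length R (M ⧸ P n) :=
    fun n => length_quot_eq (hQP n)
  have hqfin : ∀ n, c ≤ n → ql (P n) (Q n) ≠ ⊤ := by
    intro n hn h
    have := hlen n
    rw [h, top_add] at this
    exact hc (n + Pi.single i 1) (le_trans hn (by simp)) this
  have := main_ql a col I hI _ Finset.univ rfl P Q hP hQ hQP (fun n => le_rfl)
    (fun v hv => absurd (Finset.mem_univ v) hv) ⟨c, hqfin⟩
  refine this.congr c fun n hn => ?_
  have h0 := toNat_aux (a := Module.length R (M ⧸ P n)) (b := ql (P n) (Q n))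
    (c := Module.length R (M ⧸ Q n)) (d := 0) (by rw [hlen n]; ring) (hc n hn) (hqfin n hn)
    (hc _ (le_trans hn (by simp))) (by simp)
  simpa using h0
end Main1

section Numeric
open Filter Topology

lemma natDegree_le_of_eventually_le {p q : Polynomial ℚ} (N : ℕ)
    (h : ∀ t : ℕ, N ≤ t → 0 ≤ p.eval (t : ℚ) ∧ p.eval (t : ℚ) ≤ q.eval (t : ℚ)) :
    p.natDegree ≤ q.natDegree := by
  by_contra hlt
  push Not at hlt
  have hp : p ≠ 0 := by rintro rfl; simp at hlt
  have hdeg : q.degree < p.degree := Polynomial.degree_lt_degree hlt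
  have h1 := Polynomial.div_tendsto_atTop_zero_of_degree_lt q p hdeg
  have h2 : Tendsto (fun t : ℕ => (t : ℚ)) atTop atTop := tendsto_natCast_atTop_atTop
  have h3 := h1.comp h2
  have h4 := h2.eventually (Polynomial.eventually_atTop_not_isRoot p hp)
  have h5 : ∀ᶠ t : ℕ in atTop, q.eval (t : ℚ) / p.eval (t : ℚ) < 1 :=
    h3.eventually (gt_mem_nhds zero_lt_one)
  obtain ⟨t, ht4, ht5, htN⟩ := (h4.and (h5.and (eventually_ge_atTop N))).exists
  obtain ⟨ha, hb⟩ := h t htN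
  have hpos : 0 < p.eval (t : ℚ) := lt_of_le_of_ne ha (Ne.symm ht4)
  rw [div_lt_one hpos] at ht5
  linarith

lemma natDegree_diff_lt {q : Polynomial ℚ} (hq : 0 < q.natDegree) (k : ℕ) :
    (q - q.comp (Polynomial.X - Polynomial.C (k : ℚ))).natDegree < q.natDegree := by
  set s := q.comp (Polynomial.X - Polynomial.C (k : ℚ)) with hs
  have hq0 : q ≠ 0 := by rintro rfl; simp at hq
  have hn : s.natDegree = q.natDegree := by
    rw [hs, Polynomial.natDegree_comp, Polynomial.natDegree_X_sub_C, mul_one]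
  have hl : s.leadingCoeff = q.leadingCoeff := by
    rw [hs, Polynomial.leadingCoeff_comp (by rw [Polynomial.natDegree_X_sub_C]; exact one_ne_zero),
      (Polynomial.monic_X_sub_C (k : ℚ)).leadingCoeff, one_pow, mul_one]
  have hs0 : s ≠ 0 := by
    intro h; rw [h] at hn; simp at hn; omega
  by_cases hz : q - s = 0
  · rw [hz]; simpa using hq
  · exact Polynomial.natDegree_lt_natDegree hz (Polynomial.degree_sub_lt_left
      (by rw [Polynomial.degree_eq_natDegree hq0, Polynomial.degree_eq_natDegree hs0, hn]) hq0 hl.symm)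

noncomputable def lineP {r : ℕ} (a : Fin r → ℕ) (P : MvPolynomial (Fin r) ℚ) : Polynomial ℚ :=
  MvPolynomial.aeval (fun i => Polynomial.C (a i : ℚ) * Polynomial.X) P

lemma lineP_eval {r : ℕ} (a : Fin r → ℕ) (P : MvPolynomial (Fin r) ℚ) (t : ℕ) :
    (lineP a P).eval (t : ℚ) = MvPolynomial.eval (fun i => ((a i * t : ℕ) : ℚ)) P := by
  unfold lineP
  induction P using MvPolynomial.induction_on with
  | C x => simp
  | add p q hp hq => simp_all
  | mul_X p i hp => simp_all

lemma lineP_coeff {r : ℕ} (a : Fin r → ℕ) (P : MvPolynomial (Fin r) ℚ) (D : ℕ) :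
    (lineP a P).coeff D = MvPolynomial.eval (fun i => (a i : ℚ)) (MvPolynomial.homogeneousComponent D P) := by
  unfold lineP
  induction P using MvPolynomial.induction_on' with
  | monomial u x =>
    rw [MvPolynomial.homogeneousComponent_of_mem (m := D) (n := u.degree)
      (MvPolynomial.isHomogeneous_monomial x rfl), MvPolynomial.aeval_monomial,
      Finsupp.prod_fintype _ _ (by simp)]
    simp only [mul_pow, Finset.prod_mul_distrib, Finset.prod_pow_eq_pow_sum]
    have e : ∑ i, u i = u.degree := by
      rw [Finsupp.degree_eq_sum]
    rw [e]
    have e2 : ∏ x, (Polynomial.C (a x : ℚ)) ^ u x = Polynomial.C (∏ x, (a x : ℚ) ^ u x) := by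
      simp
    rw [e2, ← mul_assoc, Polynomial.algebraMap_eq, ← Polynomial.C_mul, Polynomial.coeff_C_mul_X_pow]
    split_ifs with h
    · rw [MvPolynomial.eval_monomial, Finsupp.prod_fintype _ _ (by simp)]
    · simp
  | add p q hp hq => simp_all

lemma lineP_natDegree_le {r : ℕ} (a : Fin r → ℕ) (P : MvPolynomial (Fin r) ℚ) :
    (lineP a P).natDegree ≤ P.totalDegree := by
  rw [Polynomial.natDegree_le_iff_coeff_eq_zero]
  intro N hN
  rw [lineP_coeff, MvPolynomial.homogeneousComponent_eq_zero _ _ hN, map_zero]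

lemma totalDegree_le_of_bound {r : ℕ} (P : MvPolynomial (Fin r) ℚ) (c : Fin r → ℕ) (C : ℚ) (d : ℕ)
    (h : ∀ n : Fin r → ℕ, c ≤ n → 0 ≤ MvPolynomial.eval (fun i => (n i : ℚ)) P ∧
      MvPolynomial.eval (fun i => (n i : ℚ)) P ≤ C * ((∑ i, n i : ℕ) : ℚ) ^ d) :
    P.totalDegree ≤ d := by
  by_cases hP : P = 0
  · simp [hP]
  have hD : MvPolynomial.homogeneousComponent P.totalDegree P ≠ 0 := by
    obtain ⟨u, hu, hu'⟩ := Finset.exists_mem_eq_sup P.support (MvPolynomial.support_nonempty.2 hP)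
      (fun s => s.sum fun _ e => e)
    intro h0
    have := congrArg (MvPolynomial.coeff u) h0
    rw [MvPolynomial.coeff_homogeneousComponent, if_pos] at this
    · exact MvPolynomial.mem_support_iff.1 hu (by simpa using this)
    · rw [MvPolynomial.totalDegree, hu']; rfl
  obtain ⟨a, ha, haD⟩ : ∃ a : Fin r → ℕ, (∀ i, 1 ≤ a i) ∧
      MvPolynomial.eval (fun i => (a i : ℚ)) (MvPolynomial.homogeneousComponent P.totalDegree P) ≠ 0 := by
    by_contra hcon
    push Not at hcon
    apply hD
    refine MvPolynomial.funext_set (fun _ => (fun k : ℕ => (k : ℚ)) '' Set.Ici 1) (fun i => ?_) ?_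
    · exact (Set.Ici_infinite 1).image (Nat.cast_injective.injOn)
    · intro x hx
      have hx' : ∀ i, ∃ k : ℕ, 1 ≤ k ∧ (k : ℚ) = x i := fun i => by
        obtain ⟨k, hk, hk'⟩ := hx i (Set.mem_univ i)
        exact ⟨k, hk, hk'⟩
      choose k hk hk' using hx'
      have := hcon k hk
      simp only [hk'] at this
      simpa using this
  have h1 : P.totalDegree ≤ (lineP a P).natDegree := by
    apply Polynomial.le_natDegree_of_ne_zero
    rwa [lineP_coeff]
  have h2 : (lineP a P).natDegree ≤
      (Polynomial.C (C * ((∑ i, a i : ℕ) : ℚ) ^ d) * Polynomial.X ^ d).natDegree := by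
    refine natDegree_le_of_eventually_le (∑ i, c i) fun t ht => ?_
    have hc : c ≤ fun i => a i * t := by
      intro i
      have : c i ≤ ∑ i, c i := Finset.single_le_sum (fun _ _ => Nat.zero_le _) (Finset.mem_univ i)
      exact (this.trans ht).trans (Nat.le_mul_of_pos_left _ (ha i))
    have := h _ hc
    rw [lineP_eval]
    refine ⟨this.1, this.2.trans (le_of_eq ?_)⟩
    rw [← Finset.sum_mul, Polynomial.eval_mul, Polynomial.eval_C, Polynomial.eval_pow, Polynomial.eval_X]
    push_cast
    ring
  exact h1.trans (h2.trans (Polynomial.natDegree_C_mul_X_pow_le _ _))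

end Numeric


section Hel
variable {R : Type*} [CommRing R]

lemma length_comap_eq {X Y : Type*} [AddCommGroup X] [Module R X] [AddCommGroup Y] [Module R Y]
    (f : X →ₗ[R] Y) (Q : Submodule R Y) :
    Module.length R (X ⧸ Q.comap f) = ql (Q ⊔ LinearMap.range f) Q := by
  let g : X →ₗ[R] Y ⧸ Q := Q.mkQ ∘ₗ f
  let g' : (Q ⊔ LinearMap.range f : Submodule R Y) →ₗ[R] Y ⧸ Q := Q.mkQ ∘ₗ Submodule.subtype _
  have hr : LinearMap.range g = LinearMap.range g' := by
    simp only [g, g', LinearMap.range_comp, Submodule.range_subtype, Submodule.map_sup]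
    simp [Submodule.mkQ_map_self]
  have hk : LinearMap.ker g = Q.comap f := by
    simp only [g, LinearMap.ker_comp, Submodule.ker_mkQ]
  have hk' : LinearMap.ker g' = Q.submoduleOf _ := by
    simp only [g', LinearMap.ker_comp, Submodule.ker_mkQ]; rfl
  unfold ql
  rw [← hk, ← hk', g.quotKerEquivRange.length_eq, g'.quotKerEquivRange.length_eq, hr]

lemma length_quot_mono {X : Type*} [AddCommGroup X] [Module R X] {N N' : Submodule R X} (h : N ≤ N') :
    Module.length R (X ⧸ N') ≤ Module.length R (X ⧸ N) := by
  rw [length_quot_eq h]; exact le_add_self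

lemma length_quot_pow_ne_top [IsNoetherianRing R] [IsLocalRing R] (X : Type*) [AddCommGroup X] [Module R X]
    [Module.Finite R X] (t : ℕ) :
    Module.length R (X ⧸ (IsLocalRing.maximalIdeal R ^ t • (⊤ : Submodule R X))) ≠ ⊤ := by
  set m := IsLocalRing.maximalIdeal R with hm
  have hle : Module.length R (X ⧸ (m ^ (t+1) • (⊤ : Submodule R X))) ≠ ⊤ := by
    have hne : m ^ (t+1) ≠ ⊤ := by
      intro h
      exact (IsLocalRing.maximalIdeal.isMaximal R).ne_top (top_le_iff.1 (h ▸ Ideal.pow_le_self (by omega)))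
    have : Nontrivial (R ⧸ m ^ (t+1)) := Ideal.Quotient.nontrivial_iff.2 hne
    have : IsLocalRing (R ⧸ m ^ (t+1)) :=
      IsLocalRing.of_surjective' (Ideal.Quotient.mk (m ^ (t+1))) Ideal.Quotient.mk_surjective
    have : IsArtinianRing (R ⧸ m ^ (t+1)) := by
      rw [isArtinianRing_iff_isNilpotent_maximalIdeal]
      refine ⟨t+1, ?_⟩
      have e : IsLocalRing.maximalIdeal (R ⧸ m ^ (t+1)) = m.map (Ideal.Quotient.mk (m ^ (t+1))) := by
        refine ((IsLocalRing.eq_maximalIdeal ?_)).symm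
        refine (Ideal.map_eq_top_or_isMaximal_of_surjective _ Ideal.Quotient.mk_surjective
          (IsLocalRing.maximalIdeal.isMaximal R)).resolve_left ?_
        intro h
        have := congrArg (Ideal.comap (Ideal.Quotient.mk (m ^ (t+1)))) h
        rw [Ideal.comap_map_of_surjective _ Ideal.Quotient.mk_surjective, Ideal.comap_top,
          ← RingHom.ker_eq_comap_bot, Ideal.mk_ker, sup_eq_left.2 (Ideal.pow_le_self (by omega))] at this
        exact (IsLocalRing.maximalIdeal.isMaximal R).ne_top this
      rw [e, ← Ideal.map_pow, Ideal.map_quotient_self]; rfl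
    rw [Module.length_eq_of_surjective (R := R ⧸ m ^ (t+1)) (S := R) Ideal.Quotient.mk_surjective]
    have : Module.Finite (R ⧸ m ^ (t+1)) (X ⧸ (m ^ (t+1) • (⊤ : Submodule R X))) :=
      Module.Finite.of_restrictScalars_finite R _ _
    exact Module.length_ne_top
  exact ne_top_of_le_ne_top hle (length_quot_mono (Submodule.smul_mono_left (Ideal.pow_le_pow_right (by omega))))

lemma artin_rees_length [IsNoetherianRing R] (m : Ideal R) {X Y : Type*} [AddCommGroup X] [Module R X]
    [AddCommGroup Y] [Module R Y] [Module.Finite R Y] (f : X →ₗ[R] Y) (hf : Function.Injective f) :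
    ∃ k : ℕ, ∀ t ≥ k, Module.length R (X ⧸ (m ^ (t - k) • (⊤ : Submodule R X))) +
      Module.length R (Y ⧸ (m ^ t • (⊤ : Submodule R Y) ⊔ LinearMap.range f)) ≤
      Module.length R (Y ⧸ (m ^ t • (⊤ : Submodule R Y))) := by
  obtain ⟨k, hk⟩ := Ideal.exists_pow_inf_eq_pow_smul m (LinearMap.range f)
  refine ⟨k, fun t ht => ?_⟩
  rw [length_quot_eq (Q := m ^ t • (⊤ : Submodule R Y)) (P := m ^ t • (⊤ : Submodule R Y) ⊔ LinearMap.range f) le_sup_left,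
    ← length_comap_eq]
  gcongr
  apply length_quot_mono
  intro y hy
  have h1 : f y ∈ m ^ t • (⊤ : Submodule R Y) ⊓ LinearMap.range f := ⟨hy, ⟨y, rfl⟩⟩
  rw [hk t ht] at h1
  have h2 : f y ∈ (m ^ (t - k) • (⊤ : Submodule R X)).map f := by
    rw [Submodule.map_smul'', Submodule.map_top]
    exact Submodule.smul_mono le_rfl inf_le_right h1
  obtain ⟨z, hz, hzy⟩ := h2
  rwa [← hf hzy]
end Hel


section Low
variable {R : Type*} [CommRing R] [IsNoetherianRing R] [IsLocalRing R]

/-- the Hilbert-Samuel function with respect to the maximal ideal -/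
noncomputable def hsl (R : Type*) [CommRing R] [IsLocalRing R] (X : Type*) [AddCommGroup X] [Module R X] (t : ℕ) : ℕ :=
  (Module.length R (X ⧸ (IsLocalRing.maximalIdeal R ^ t • (⊤ : Submodule R X)))).toNat

lemma coe_hsl (X : Type*) [AddCommGroup X] [Module R X] [Module.Finite R X] (t : ℕ) :
    (hsl R X t : ℕ∞) = Module.length R (X ⧸ (IsLocalRing.maximalIdeal R ^ t • (⊤ : Submodule R X))) :=
  ENat.natCast_toNat (length_quot_pow_ne_top X t)

def IsHS (R : Type*) [CommRing R] [IsLocalRing R] (X : Type*) [AddCommGroup X] [Module R X] (H : Polynomial ℚ) : Prop :=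
  ∃ N : ℕ, ∀ t : ℕ, N ≤ t → (hsl R X t : ℚ) = H.eval (t : ℚ)

lemma exists_isHS (X : Type*) [AddCommGroup X] [Module R X] [Module.Finite R X] :
    ∃ H, IsHS R X H := by
  have e : ∀ n : Fin 1 → ℕ, prodPow (fun _ => IsLocalRing.maximalIdeal R) n =
      IsLocalRing.maximalIdeal R ^ n 0 := fun n => Fin.prod_univ_one _
  obtain ⟨c, P, hP⟩ := main_poly (R := R) (M := X) (r := 1) (fun _ => IsLocalRing.maximalIdeal R)
    ⟨0, fun n _ => by rw [e]; exact length_quot_pow_ne_top X (n 0)⟩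
  refine ⟨lineP (fun _ => 1) P, c 0, fun t ht => ?_⟩
  have := hP (fun _ => t) (fun i => by rw [Subsingleton.elim i 0]; exact ht)
  rw [lineP_eval, hsl]
  simp only [one_mul]
  rw [← this]
  beta_reduce
  rw [e]

lemma one_le_hsl (X : Type*) [AddCommGroup X] [Module R X] [Module.Finite R X] [Nontrivial X] {t : ℕ} (ht : 1 ≤ t) :
    1 ≤ hsl R X t := by
  have : Nontrivial (X ⧸ (IsLocalRing.maximalIdeal R ^ t • (⊤ : Submodule R X))) := by
    rw [Submodule.Quotient.nontrivial_iff]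
    intro h
    have := Submodule.eq_bot_of_le_smul_of_le_jacobson_bot (IsLocalRing.maximalIdeal R ^ t) (⊤ : Submodule R X)
      Module.Finite.fg_top h.ge ((Ideal.pow_le_self (by omega)).trans (IsLocalRing.maximalIdeal_le_jacobson _))
    exact top_ne_bot this
  have h1 := Module.length_pos (R := R) (M := X ⧸ (IsLocalRing.maximalIdeal R ^ t • (⊤ : Submodule R X)))
  rw [← coe_hsl] at h1
  exact_mod_cast h1

lemma hs_step {p p1 : Ideal R} [p.IsPrime] [p1.IsPrime] (hlt : p < p1) {H H1 : Polynomial ℚ}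
    (hH : IsHS R (R ⧸ p) H) (hH1 : IsHS R (R ⧸ p1) H1) : H1.natDegree < H.natDegree := by
  obtain ⟨x, hx1, hx⟩ := SetLike.exists_of_lt hlt
  let f : (R ⧸ p) →ₗ[R] (R ⧸ p) := LinearMap.lsmul R (R ⧸ p) x
  have hf : Function.Injective f := by
    rw [← LinearMap.ker_eq_bot, LinearMap.ker_eq_bot']
    intro y hy
    have hy' : (Ideal.Quotient.mk p x) * y = 0 := by
      rw [← hy]; simp only [f, LinearMap.lsmul_apply, Algebra.smul_def]; rfl
    refine (mul_eq_zero.1 hy').resolve_left ?_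
    rwa [Ideal.Quotient.eq_zero_iff_mem]
  obtain ⟨k, hk⟩ := artin_rees_length (IsLocalRing.maximalIdeal R) f hf
  have key : ∀ t ≥ k, hsl R (R ⧸ p) (t - k) + hsl R (R ⧸ p1) t ≤ hsl R (R ⧸ p) t := by
    intro t ht
    have h1 := hk t ht
    have h2 : Module.length R ((R ⧸ p1) ⧸ (IsLocalRing.maximalIdeal R ^ t • (⊤ : Submodule R (R ⧸ p1)))) ≤
        Module.length R ((R ⧸ p) ⧸ (IsLocalRing.maximalIdeal R ^ t • (⊤ : Submodule R (R ⧸ p)) ⊔ LinearMap.range f)) := by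
      let φ : (R ⧸ p) →ₗ[R] (R ⧸ p1) := Submodule.factor hlt.le
      have hφ : Function.Surjective φ := Submodule.factor_surjective hlt.le
      let g := (IsLocalRing.maximalIdeal R ^ t • (⊤ : Submodule R (R ⧸ p1))).mkQ ∘ₗ φ
      have hg : Function.Surjective g := (Submodule.mkQ_surjective _).comp hφ
      have hker : IsLocalRing.maximalIdeal R ^ t • (⊤ : Submodule R (R ⧸ p)) ⊔ LinearMap.range f ≤ LinearMap.ker g := by
        refine sup_le ?_ ?_
        · rw [LinearMap.ker_comp, Submodule.ker_mkQ, ← Submodule.map_le_iff_le_comap, Submodule.map_smul'']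
          exact Submodule.smul_mono le_rfl le_top
        · rintro _ ⟨y, rfl⟩
          have : φ (f y) = 0 := by
            obtain ⟨y, rfl⟩ := Ideal.Quotient.mk_surjective y
            have : φ (f (Ideal.Quotient.mk p y)) = Ideal.Quotient.mk p1 (x * y) := rfl
            rw [this, Ideal.Quotient.eq_zero_iff_mem]
            exact Ideal.mul_mem_right _ _ hx1
          simp [g, this]
      refine Module.length_le_of_surjective (Submodule.liftQ _ g hker) ?_
      intro y
      obtain ⟨z, rfl⟩ := hg y
      exact ⟨Submodule.Quotient.mk z, rfl⟩
    have h3 := (add_le_add_right h2 _).trans h1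
    rw [← coe_hsl, ← coe_hsl, ← coe_hsl] at h3
    exact_mod_cast h3
  obtain ⟨N, hN⟩ := hH
  obtain ⟨N1, hN1⟩ := hH1
  have key2 : ∀ t : ℕ, N + N1 + k + 1 ≤ t → 1 ≤ H1.eval (t : ℚ) ∧
      H1.eval (t : ℚ) ≤ (H - H.comp (Polynomial.X - Polynomial.C (k : ℚ))).eval (t : ℚ) := by
    intro t ht
    have h1 := key t (by omega)
    have h2 : 1 ≤ hsl R (R ⧸ p1) t := one_le_hsl _ (by omega)
    have e1 := hN t (by omega)
    have e2 := hN (t - k) (by omega)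
    have e3 := hN1 t (by omega)
    rw [Polynomial.eval_sub, Polynomial.eval_comp, Polynomial.eval_sub, Polynomial.eval_X, Polynomial.eval_C,
      ← Nat.cast_sub (by omega), ← e1, ← e2, ← e3]
    refine ⟨by exact_mod_cast h2, ?_⟩
    have : (hsl R (R ⧸ p) (t - k) : ℚ) + hsl R (R ⧸ p1) t ≤ hsl R (R ⧸ p) t := by exact_mod_cast h1
    linarith
  have hpos : 0 < H.natDegree := by
    by_contra h0
    obtain ⟨a, ha⟩ := Polynomial.natDegree_eq_zero.1 (by omega : H.natDegree = 0)
    have := key2 (N + N1 + k + 1) le_rfl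
    rw [← ha, Polynomial.C_comp, sub_self, Polynomial.eval_zero] at this
    linarith
  refine lt_of_le_of_lt (natDegree_le_of_eventually_le (N + N1 + k + 1) fun t ht => ?_) (natDegree_diff_lt hpos k)
  obtain ⟨h1, h2⟩ := key2 t ht
  exact ⟨by linarith, h2⟩

lemma hs_series (d : ℕ) : ∀ s : LTSeries (PrimeSpectrum R), s.length = d → ∀ H,
    IsHS R (R ⧸ s.head.asIdeal) H → d ≤ H.natDegree := by
  induction d with
  | zero => intros; exact Nat.zero_le _
  | succ d ih =>
    intro s hs H hH
    have hne : s.length ≠ 0 := by omega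
    obtain ⟨H1, hH1⟩ := exists_isHS (R := R) (R ⧸ (s.tail hne).head.asIdeal)
    have h1 := ih (s.tail hne) (by rw [RelSeries.tail_length]; omega) H1 hH1
    have hlt : s.head < (s.tail hne).head := by
      rw [RelSeries.head_tail]
      exact s.strictMono (by
        rw [Fin.lt_def, Fin.coe_ofNat_eq_mod, Fin.coe_ofNat_eq_mod, Nat.zero_mod, Nat.mod_eq_of_lt] <;> omega)
    have := hs_step (p := s.head.asIdeal) (p1 := (s.tail hne).head.asIdeal) hlt hH hH1
    omega

lemma hs_lower (M : Type*) [AddCommGroup M] [Module R M] [Module.Finite R M] (d : ℕ)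
    (hd : (d : WithBot ℕ∞) ≤ ringKrullDim (R ⧸ Module.annihilator R M)) (Q : Polynomial ℚ) (N0 : ℕ)
    (hQ : ∀ t : ℕ, N0 ≤ t → (hsl R M t : ℚ) ≤ Q.eval (t : ℚ)) : d ≤ Q.natDegree := by
  obtain ⟨l, hl⟩ := Order.le_krullDim_iff.1 hd
  have hsm : StrictMono (PrimeSpectrum.comap (Ideal.Quotient.mk (Module.annihilator R M))) :=
    Monotone.strictMono_of_injective (fun a b h => Ideal.comap_mono h)
      (PrimeSpectrum.comap_injective_of_surjective _ Ideal.Quotient.mk_surjective)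
  set l' := l.map _ hsm with hl'
  have hann : Module.annihilator R M ≤ l'.head.asIdeal := by
    rw [hl', LTSeries.head_map]
    intro x hx
    change Ideal.Quotient.mk (Module.annihilator R M) x ∈ l.head.asIdeal
    rw [Ideal.Quotient.eq_zero_iff_mem.2 hx]
    exact Ideal.zero_mem _
  obtain ⟨p, hp, hple⟩ := Ideal.exists_minimalPrimes_le hann
  have hass := Module.associatedPrimes.minimalPrimes_annihilator_subset_associatedPrimes R M hp
  obtain ⟨hprime, x, hx⟩ := Submodule.isAssociatedPrime_iff.1 hass
  let p' : PrimeSpectrum R := ⟨p, hprime⟩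
  have hco : (d : ℕ∞) ≤ Order.coheight p' := by
    have h1 : (l'.length : ℕ∞) ≤ _ := Order.length_le_coheight_head
    have h2 : l'.length = d := hl
    rw [h2] at h1
    exact h1.trans (Order.coheight_anti (show p' ≤ l'.head from hple))
  obtain ⟨s, hs, hslen⟩ := Order.exists_series_of_le_coheight p' hco
  obtain ⟨H, hH⟩ := exists_isHS (R := R) (R ⧸ s.head.asIdeal)
  have hdeg := hs_series d s hslen H hH
  rw [hs] at hH
  change IsHS R (R ⧸ p) H at hH
  have hker : LinearMap.ker (LinearMap.toSpanSingleton R M x) = p := by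
    rw [hx]; ext y; simp [Submodule.mem_colon_singleton]
  let f : (R ⧸ p) →ₗ[R] M := Submodule.liftQ p (LinearMap.toSpanSingleton R M x) hker.ge
  have hf : Function.Injective f := by
    rw [← LinearMap.ker_eq_bot]
    exact Submodule.ker_liftQ_eq_bot _ _ _ hker.le
  obtain ⟨k, hk⟩ := artin_rees_length (IsLocalRing.maximalIdeal R) f hf
  obtain ⟨N, hN⟩ := hH
  refine hdeg.trans ?_
  have hcomp : (Q.comp (Polynomial.X + Polynomial.C (k : ℚ))).natDegree = Q.natDegree := by
    rw [Polynomial.natDegree_comp, Polynomial.natDegree_X_add_C, mul_one]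
  rw [← hcomp]
  refine natDegree_le_of_eventually_le (N + N0) fun t ht => ?_
  rw [Polynomial.eval_comp, Polynomial.eval_add, Polynomial.eval_X, Polynomial.eval_C, ← Nat.cast_add,
    ← hN t (by omega)]
  refine ⟨by positivity, le_trans ?_ (hQ (t + k) (by omega))⟩
  have h1 := le_trans le_self_add (hk (t + k) (by omega))
  rw [Nat.add_sub_cancel, ← coe_hsl, ← coe_hsl] at h1
  exact_mod_cast h1
end Low


section Upp
variable {R : Type*} [CommRing R] {M : Type*} [AddCommGroup M] [Module R M]

lemma length_xpow (N : Submodule R M) (x : R) (k : ℕ) :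
    Module.length R (M ⧸ (N ⊔ LinearMap.range (LinearMap.lsmul R M (x ^ k)))) ≤
      k * Module.length R (M ⧸ (N ⊔ LinearMap.range (LinearMap.lsmul R M x))) := by
  induction k with
  | zero =>
    have : N ⊔ LinearMap.range (LinearMap.lsmul R M (x ^ 0)) = ⊤ := by
      rw [eq_top_iff]
      refine le_trans ?_ le_sup_right
      intro y _
      exact ⟨y, by simp⟩
    rw [this, Module.length_eq_zero_iff.2 (Submodule.Quotient.subsingleton_iff.2 rfl)]
    exact zero_le
  | succ k ih =>
    have hle : LinearMap.range (LinearMap.lsmul R M (x ^ (k+1))) ≤ LinearMap.range (LinearMap.lsmul R M x) := by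
      rintro _ ⟨y, rfl⟩
      exact ⟨x ^ k • y, by simp only [LinearMap.lsmul_apply, smul_smul, pow_succ']⟩
    rw [length_quot_eq (sup_le_sup_left hle N)]
    have e : N ⊔ LinearMap.range (LinearMap.lsmul R M x) =
        (N ⊔ LinearMap.range (LinearMap.lsmul R M (x ^ (k+1)))) ⊔ LinearMap.range (LinearMap.lsmul R M x) := by
      rw [sup_assoc, sup_eq_right.2 hle]
    have h2 : ql (N ⊔ LinearMap.range (LinearMap.lsmul R M x))
        (N ⊔ LinearMap.range (LinearMap.lsmul R M (x ^ (k+1)))) ≤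
        k * Module.length R (M ⧸ (N ⊔ LinearMap.range (LinearMap.lsmul R M x))) := by
      conv_lhs => rw [e]
      rw [← length_comap_eq]
      refine le_trans (length_quot_mono ?_) ih
      refine sup_le ?_ ?_
      · intro y hy
        exact Submodule.mem_sup_left (N.smul_mem x hy)
      · rintro _ ⟨y, rfl⟩
        exact Submodule.mem_sup_right ⟨y, by simp only [LinearMap.lsmul_apply, smul_smul, pow_succ']⟩
    refine (add_le_add_left h2 _).trans ?_
    rw [Nat.cast_add, add_mul, Nat.cast_one, one_mul]

lemma length_xpow_finset [DecidableEq R] (s : Finset R) (k : ℕ) : ∀ (N : Submodule R M),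
    Module.length R (M ⧸ (N ⊔ s.sup fun x => LinearMap.range (LinearMap.lsmul R M (x ^ k)))) ≤
      (k : ℕ∞) ^ s.card * Module.length R (M ⧸ (N ⊔ s.sup fun x => LinearMap.range (LinearMap.lsmul R M x))) := by
  induction s using Finset.induction_on with
  | empty => intro N; rw [Finset.sup_empty, Finset.sup_empty, Finset.card_empty, pow_zero, one_mul]
  | insert a s ha ih =>
    intro N
    rw [Finset.sup_insert, Finset.sup_insert, ← sup_assoc, Finset.card_insert_of_notMem ha]
    refine (ih _).trans ?_
    rw [sup_right_comm, pow_succ, mul_assoc]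
    gcongr
    refine (length_xpow _ a k).trans (le_of_eq ?_)
    rw [sup_right_comm, sup_assoc]

lemma smul_top_mul {J1 K1 J2 K2 : Ideal R} (h1 : J1 • (⊤ : Submodule R M) ≤ K1 • ⊤)
    (h2 : J2 • (⊤ : Submodule R M) ≤ K2 • ⊤) : (J1 * J2) • (⊤ : Submodule R M) ≤ (K1 * K2) • ⊤ := by
  rw [Submodule.mul_smul, mul_comm K1, Submodule.mul_smul]
  refine (Submodule.smul_mono le_rfl h2).trans ?_
  rw [← Submodule.mul_smul, mul_comm J1, Submodule.mul_smul]
  exact Submodule.smul_mono le_rfl h1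

lemma smul_top_pow {J K : Ideal R} (h : J • (⊤ : Submodule R M) ≤ K • ⊤) (n : ℕ) :
    J ^ n • (⊤ : Submodule R M) ≤ K ^ n • ⊤ := by
  induction n with
  | zero => simp
  | succ n ih => rw [pow_succ, pow_succ]; exact smul_top_mul ih h

lemma smul_top_prod {r : ℕ} {J : Ideal R} {I : Fin r → Ideal R} (h : ∀ i, J • (⊤ : Submodule R M) ≤ I i • ⊤)
    (n : Fin r → ℕ) : J ^ (∑ i, n i) • (⊤ : Submodule R M) ≤ prodPow I n • ⊤ := by
  rw [← Finset.prod_pow_eq_pow_sum]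
  unfold prodPow
  induction (Finset.univ : Finset (Fin r)) using Finset.induction_on with
  | empty => simp
  | insert a s ha ih =>
    rw [Finset.prod_insert ha, Finset.prod_insert ha]
    exact smul_top_mul (smul_top_pow (h a) _) ih

lemma prodPow_le {r : ℕ} (I : Fin r → Ideal R) (n : Fin r → ℕ) (i : Fin r) (hn : 1 ≤ n i) :
    prodPow I n ≤ I i := by
  have h1 : I i ^ n i ∣ prodPow I n := Finset.dvd_prod_of_mem _ (Finset.mem_univ i)
  exact (Ideal.le_of_dvd h1).trans (Ideal.pow_le_self (by omega))

variable [IsNoetherianRing R] [IsLocalRing R] [Module.Finite R M]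

lemma exists_pow_le (N : Submodule R M) (h : Module.length R (M ⧸ N) ≠ ⊤) :
    ∃ k, IsLocalRing.maximalIdeal R ^ k • (⊤ : Submodule R M) ≤ N := by
  have hA : IsArtinian R (M ⧸ N) :=
    ((isFiniteLength_iff_isNoetherian_isArtinian).1 (Module.length_ne_top_iff.1 h)).2
  let f : ℕ →o (Submodule R (M ⧸ N))ᵒᵈ :=
    ⟨fun k => OrderDual.toDual (IsLocalRing.maximalIdeal R ^ k • (⊤ : Submodule R (M ⧸ N))), fun a b hab =>
      OrderDual.toDual_le_toDual.2 (Submodule.smul_mono_left (Ideal.pow_le_pow_right hab))⟩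
  obtain ⟨k, hk⟩ := IsArtinian.monotone_stabilizes f
  have h1 : IsLocalRing.maximalIdeal R ^ k • (⊤ : Submodule R (M ⧸ N)) =
    IsLocalRing.maximalIdeal R ^ (k+1) • (⊤ : Submodule R (M ⧸ N)) := hk (k+1) (by omega)
  have h2 := Submodule.eq_bot_of_le_smul_of_le_jacobson_bot (IsLocalRing.maximalIdeal R)
    (IsLocalRing.maximalIdeal R ^ k • (⊤ : Submodule R (M ⧸ N))) (IsNoetherian.noetherian _)
    (by rw [← Submodule.mul_smul, ← pow_succ', ← h1]) (IsLocalRing.maximalIdeal_le_jacobson _)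
  refine ⟨k, ?_⟩
  have h3 : (IsLocalRing.maximalIdeal R ^ k • (⊤ : Submodule R M)).map N.mkQ = ⊥ := by
    rw [Submodule.map_smul'', Submodule.map_top, Submodule.range_mkQ, h2]
  intro y hy
  have h4 : N.mkQ y ∈ (IsLocalRing.maximalIdeal R ^ k • (⊤ : Submodule R M)).map N.mkQ := ⟨y, hy, rfl⟩
  rw [h3, Submodule.mem_bot] at h4
  simpa using h4

lemma exists_sop (M : Type*) [AddCommGroup M] [Module R M] [Module.Finite R M] [Nontrivial M] :
    ∃ s : Finset R, ∃ d : ℕ, ringKrullDim (R ⧸ Module.annihilator R M) = (d : WithBot ℕ∞) ∧ s.card ≤ d ∧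
      (∀ x ∈ s, x ∈ IsLocalRing.maximalIdeal R) ∧
      ∃ e : ℕ, IsLocalRing.maximalIdeal R ^ e • (⊤ : Submodule R M) ≤
        s.sup fun x => LinearMap.range (LinearMap.lsmul R M x) := by
  classical
  set a := Module.annihilator R M with ha
  have hnt : Nontrivial (R ⧸ a) := by
    rw [Ideal.Quotient.nontrivial_iff, ha, Ne, Module.annihilator_eq_top_iff]
    exact not_subsingleton M
  have hloc : IsLocalRing (R ⧸ a) :=
    IsLocalRing.of_surjective' (Ideal.Quotient.mk a) Ideal.Quotient.mk_surjective
  obtain ⟨s', hs', hcard⟩ :=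
    Ideal.exists_finset_card_eq_height_of_isNoetherianRing (IsLocalRing.maximalIdeal (R ⧸ a))
  have hrad : IsLocalRing.maximalIdeal (R ⧸ a) ≤ (Ideal.span (s' : Set (R ⧸ a))).radical := by
    rw [Ideal.radical_eq_sInf]
    refine le_sInf ?_
    rintro J ⟨hJ1, hJ2⟩
    exact hs'.2 ⟨hJ2, hJ1⟩ (IsLocalRing.le_maximalIdeal hJ2.ne_top)
  obtain ⟨e, he⟩ := Ideal.exists_pow_le_of_le_radical_of_fg hrad (IsNoetherian.noetherian _)
  have hcomap : (IsLocalRing.maximalIdeal (R ⧸ a)).comap (Ideal.Quotient.mk a) = IsLocalRing.maximalIdeal R :=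
    IsLocalRing.eq_maximalIdeal (Ideal.comap_isMaximal_of_surjective _ Ideal.Quotient.mk_surjective)
  let σ : R ⧸ a → R := Function.surjInv (Ideal.Quotient.mk_surjective (I := a))
  have hσ : ∀ y, Ideal.Quotient.mk a (σ y) = y := Function.surjInv_eq _
  refine ⟨s'.image σ, s'.card, ?_, Finset.card_image_le, ?_, e, ?_⟩
  · rw [← IsLocalRing.maximalIdeal_height_eq_ringKrullDim, ← hcard]; rfl
  · intro x hx
    obtain ⟨y, hy, rfl⟩ := Finset.mem_image.1 hx
    rw [← hcomap, Ideal.mem_comap, hσ]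
    exact hs'.1.2 (Ideal.subset_span hy)
  · have h1 : IsLocalRing.maximalIdeal R ^ e ≤ Ideal.span ((s'.image σ : Finset R) : Set R) ⊔ a := by
      have h2 : (IsLocalRing.maximalIdeal R ^ e).map (Ideal.Quotient.mk a) ≤
          (Ideal.span ((s'.image σ : Finset R) : Set R)).map (Ideal.Quotient.mk a) := by
        rw [Ideal.map_pow, Ideal.map_span]
        refine (Ideal.pow_right_mono (Ideal.map_le_iff_le_comap.2 hcomap.ge) e).trans (he.trans ?_)
        refine Ideal.span_mono ?_
        intro y hy
        exact ⟨σ y, by simpa using ⟨y, hy, rfl⟩, hσ y⟩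
      have h3 := Ideal.map_le_iff_le_comap.1 h2
      rwa [Ideal.comap_map_of_surjective _ Ideal.Quotient.mk_surjective, ← RingHom.ker_eq_comap_bot,
        Ideal.mk_ker] at h3
    refine (Submodule.smul_mono_left h1).trans ?_
    rw [Submodule.sup_smul]
    refine sup_le ?_ ?_
    · refine Submodule.smul_le.2 fun x hx y _ => ?_
      induction hx using Submodule.span_induction with
      | mem x hx =>
        exact Finset.le_sup (f := fun x => LinearMap.range (LinearMap.lsmul R M x)) hx ⟨y, rfl⟩
      | zero => rw [zero_smul]; exact Submodule.zero_mem _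
      | add u v _ _ hu hv => rw [add_smul]; exact Submodule.add_mem _ hu hv
      | smul u v _ hv => rw [smul_assoc]; exact Submodule.smul_mem _ _ hv
    · refine Submodule.smul_le.2 fun x hx y _ => ?_
      rw [Module.mem_annihilator.1 hx y]
      exact Submodule.zero_mem _

lemma length_upper [Nontrivial M] {r : ℕ} (I : Fin r → Ideal R)
    (hfin : ∃ c : Fin r → ℕ, ∀ n, c ≤ n → Module.length R (M ⧸ (prodPow I n • (⊤ : Submodule R M))) ≠ ⊤) :
    ∃ d L k : ℕ, ringKrullDim (R ⧸ Module.annihilator R M) = (d : WithBot ℕ∞) ∧ ∀ n : Fin r → ℕ,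
      1 ≤ ∑ i, n i →
      Module.length R (M ⧸ (prodPow I n • (⊤ : Submodule R M))) ≤ (((k * ∑ i, n i) ^ d * L : ℕ) : ℕ∞) := by
  classical
  obtain ⟨c, hc⟩ := hfin
  obtain ⟨k0, hk0⟩ := exists_pow_le _ (hc (c + 1) (by simp))
  obtain ⟨k, hk1, hk⟩ : ∃ k, 1 ≤ k ∧ IsLocalRing.maximalIdeal R ^ k • (⊤ : Submodule R M) ≤
      prodPow I (c + 1) • ⊤ :=
    ⟨k0 + 1, by omega, (Submodule.smul_mono_left (Ideal.pow_le_pow_right (by omega))).trans hk0⟩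
  have hk' : ∀ i, IsLocalRing.maximalIdeal R ^ k • (⊤ : Submodule R M) ≤ I i • ⊤ := fun i =>
    hk.trans (Submodule.smul_mono_left (prodPow_le I _ i (by simp)))
  obtain ⟨s, d, hd, hsd, hsm, e, he⟩ := exists_sop (R := R) M
  have hL : Module.length R (M ⧸ (s.sup fun x => LinearMap.range (LinearMap.lsmul R M x))) ≠ ⊤ :=
    ne_top_of_le_ne_top (length_quot_pow_ne_top M e) (length_quot_mono he)
  obtain ⟨L, hLe⟩ := ENat.ne_top_iff_exists.1 hL
  refine ⟨d, L, k, hd, fun n hn => ?_⟩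
  have h1 : (s.sup fun x => LinearMap.range (LinearMap.lsmul R M (x ^ (k * ∑ i, n i)))) ≤
      prodPow I n • (⊤ : Submodule R M) := by
    refine le_trans ?_ (smul_top_prod hk' n)
    refine Finset.sup_le fun x hx => ?_
    rintro _ ⟨y, rfl⟩
    rw [← pow_mul]
    exact Submodule.smul_mem_smul (Ideal.pow_mem_pow (hsm x hx) _) trivial
  refine (length_quot_mono h1).trans ?_
  have h2 := length_xpow_finset (M := M) s (k * ∑ i, n i) ⊥
  rw [bot_sup_eq, bot_sup_eq, ← hLe] at h2
  refine h2.trans ?_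
  have : (k * ∑ i, n i) ^ s.card * L ≤ (k * ∑ i, n i) ^ d * L :=
    Nat.mul_le_mul_right _ (Nat.pow_le_pow_right (Nat.mul_pos hk1 hn) hsd)
  exact_mod_cast this

lemma degree_eq [Nontrivial M] {r : ℕ} (hr : 1 ≤ r) (I : Fin r → Ideal R) (hI : ∀ i, I i ≠ ⊤)
    (hfin : ∃ c : Fin r → ℕ, ∀ n, c ≤ n → Module.length R (M ⧸ (prodPow I n • (⊤ : Submodule R M))) ≠ ⊤)
    (c : Fin r → ℕ) (P : MvPolynomial (Fin r) ℚ)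
    (hP : ∀ n, c ≤ n → ((Module.length R (M ⧸ (prodPow I n • (⊤ : Submodule R M)))).toNat : ℚ) =
      MvPolynomial.eval (fun i => (n i : ℚ)) P) :
    (P.totalDegree : WithBot ℕ∞) = ringKrullDim (R ⧸ Module.annihilator R M) := by
  obtain ⟨d, L, k, hd, hle⟩ := length_upper I hfin
  obtain ⟨c0, hc0⟩ := hfin
  rw [hd]
  have hupp : P.totalDegree ≤ d := by
    refine totalDegree_le_of_bound P (c + 1) (((k ^ d * L : ℕ)) : ℚ) d fun n hn => ?_
    rw [← hP n (le_trans (by simp) hn)]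
    refine ⟨by positivity, ?_⟩
    have hpos : 1 ≤ ∑ i, n i := by
      have h0 : 1 ≤ n ⟨0, hr⟩ := le_trans (by simp) (hn ⟨0, hr⟩)
      exact h0.trans (Finset.single_le_sum (f := n) (fun _ _ => Nat.zero_le _) (Finset.mem_univ _))
    have h1 := ENat.toNat_le_of_le_natCast (hle n hpos)
    calc _ ≤ (((k * ∑ i, n i) ^ d * L : ℕ) : ℚ) := by exact_mod_cast h1
      _ = _ := by push_cast; ring
  have hlow : d ≤ P.totalDegree := by
    refine le_trans (hs_lower M d hd.ge (lineP (fun _ => 1) P) (∑ i, c i + ∑ i, c0 i) fun t ht => ?_)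
      (lineP_natDegree_le (fun _ => 1) P)
    have hct : c ≤ fun _ => t := fun i =>
      (Finset.single_le_sum (f := c) (fun _ _ => Nat.zero_le _) (Finset.mem_univ i)).trans (by beta_reduce; omega)
    have hct0 : c0 ≤ fun _ => t := fun i =>
      (Finset.single_le_sum (f := c0) (fun _ _ => Nat.zero_le _) (Finset.mem_univ i)).trans (by beta_reduce; omega)
    rw [lineP_eval]
    simp only [one_mul]
    rw [← hP _ hct]
    have h1 : prodPow I (fun _ => t) ≤ IsLocalRing.maximalIdeal R ^ t := by
      have h1 : I ⟨0, hr⟩ ^ t ∣ prodPow I (fun _ => t) :=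
        Finset.dvd_prod_of_mem (fun i => I i ^ t) (Finset.mem_univ _)
      exact (Ideal.le_of_dvd h1).trans (Ideal.pow_right_mono (IsLocalRing.le_maximalIdeal (hI _)) t)
    have h2 := length_quot_mono (Submodule.smul_mono_left (N := (⊤ : Submodule R M)) h1)
    have h3 := ENat.toNat_le_toNat h2 (hc0 _ hct0)
    exact_mod_cast h3
  rw [le_antisymm hupp hlow]
end Upp

/-- if `λ_R(M/IⁿM)` is finite for all `n ≫ 0`, it is eventually a
polynomial `P` in `n`; moreover if `R` is local, `M ≠ 0` and each `I_i` is proper, then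
`P` can be chosen of total degree `dim_R M = dim (R/ann_R M)`. -/
theorem stmt9 {R : Type*} [CommRing R] [IsNoetherianRing R]
    {r : ℕ} (hr : 1 ≤ r) (I : Fin r → Ideal R)
    (M : Type*) [AddCommGroup M] [Module R M] [Module.Finite R M]
    (hfin : ∃ c₀ : Fin r → ℕ, ∀ n : Fin r → ℕ, c₀ ≤ n →
      moduleLength R (M ⧸ (prodPow I n • (⊤ : Submodule R M))) ≠ ⊤) :
    ∃ (c : Fin r → ℕ) (P : MvPolynomial (Fin r) ℚ),
      (∀ n : Fin r → ℕ, c ≤ n →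
        ∃ m : ℕ,
          moduleLength R (M ⧸ (prodPow I n • (⊤ : Submodule R M))) = m ∧
          (m : ℚ) = MvPolynomial.eval (fun i => (n i : ℚ)) P) ∧
      ((IsLocalRing R ∧ Nontrivial M ∧ (∀ i, I i ≠ ⊤)) →
        (P.totalDegree : WithBot ℕ∞) = ringKrullDim (R ⧸ Module.annihilator R M)) := by
  classical
  have hcoe : ∀ n : Fin r → ℕ, moduleLength R (M ⧸ (prodPow I n • (⊤ : Submodule R M))) =
      ((Module.length R (M ⧸ (prodPow I n • (⊤ : Submodule R M))) : ℕ∞) : WithBot ℕ∞) := fun n =>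
    (Module.coe_length R _).symm
  obtain ⟨c0, hc0⟩ := hfin
  have hfin' : ∀ n : Fin r → ℕ, c0 ≤ n →
      Module.length R (M ⧸ (prodPow I n • (⊤ : Submodule R M))) ≠ ⊤ := by
    intro n hn h
    exact hc0 n hn (by rw [hcoe, h]; rfl)
  obtain ⟨c, P, hP⟩ := main_poly (M := M) I ⟨c0, hfin'⟩
  refine ⟨c ⊔ c0, P, fun n hn => ?_, ?_⟩
  · refine ⟨(Module.length R (M ⧸ (prodPow I n • (⊤ : Submodule R M)))).toNat, ?_,
      hP n (le_trans le_sup_left hn)⟩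
    rw [hcoe]
    have h1 := ENat.natCast_toNat (hfin' n (le_trans le_sup_right hn))
    conv_lhs => rw [← h1]
    rfl
  · rintro ⟨h1, h2, h3⟩
    exact degree_eq hr I h3 ⟨c0, hfin'⟩ c P hP
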